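/- Let a(𝐳), b(𝐳) be local homogeneous End(E)-valued distributions with a reduced OPE {c^i(𝐳,𝐰), 𝐡_i}_{1≤i≤r}. Then for every c∈E and every i, the support of the two-variable distribution c^i(𝐳,𝐰)c satisfies: its projection to the 𝐳-variable pair is contained in supp(a(𝐳)c)+ℤ², and its projection to the 𝐰-variable pair is contained in supp(b(𝐰)c)+ℤ², where supp(a(𝐳)c) := {𝐧∈K² : a_𝐧 c ≠ 0}. -/

import Mathlib

open scoped BigOperators Classical

noncomputable section

namespace OPEA

variable (K : Type*) [Field K] [CharZero K]

/-- index pairs 𝐧 = (n, n̄) ∈ K² -/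
abbrev Idx := K × K

def IsInt (x : K) : Prop := ∃ k : ℤ, (k : K) = x

def IsNegInt (x : K) : Prop := ∃ k : ℤ, k < 0 ∧ (k : K) = x

/-- 𝕂̄ = {𝐧 ∈ K² | n − n̄ ∈ ℤ} -/
def Kbar (n : Idx K) : Prop := IsInt K (n.1 - n.2)

def IsIntPair (n : Idx K) : Prop := IsInt K n.1 ∧ IsInt K n.2

/-- generalized binomial coefficient C(x,k) -/
def gchoose (x : K) (k : ℕ) : K :=
  (∏ i ∈ Finset.range k, (x - (i : K))) / (k.factorial : K)

/-- (−1)^x for x an integer image in K (and 1 otherwise) -/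
def negOnePow (x : K) : K :=
  if h : ∃ k : ℤ, (k : K) = x then (-1 : K) ^ h.choose else 1

variable (M : Type*) [AddCommGroup M] [Module K M]

/-- M-valued distribution in one variable pair -/
abbrev Dist1 := Idx K → M

/-- M-valued distribution in two variable pairs -/
abbrev Dist2 := Idx K → Idx K → M

/-- M-valued distribution in r variable pairs -/
abbrev DistN (r : ℕ) := (Fin r → Idx K) → M

/-- membership in M[[𝐳]] -/
def IsPow1 (a : Dist1 K M) : Prop := ∀ n, a n ≠ 0 → IsNegInt K n.1 ∧ IsNegInt K n.2

/-- membership in M⌊𝐳⌋ -/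
def InLat1 (a : Dist1 K M) : Prop :=
  ∃ S : Finset (Idx K), ∀ n, a n ≠ 0 →
    ∃ m ∈ S, IsNegInt K (n.1 - m.1) ∧ IsNegInt K (n.2 - m.2)

/-- membership in M[[𝐳,𝐰]] -/
def IsPow2 (a : Dist2 K M) : Prop :=
  ∀ n k, a n k ≠ 0 →
    (IsNegInt K n.1 ∧ IsNegInt K n.2) ∧ (IsNegInt K k.1 ∧ IsNegInt K k.2)

/-- membership in M⌊𝐳,𝐰⌋ -/
def InLat2 (a : Dist2 K M) : Prop :=
  ∃ S : Finset (Idx K × Idx K), ∀ n k, a n k ≠ 0 →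
    ∃ m ∈ S, (IsNegInt K (n.1 - m.1.1) ∧ IsNegInt K (n.2 - m.1.2)) ∧
      (IsNegInt K (k.1 - m.2.1) ∧ IsNegInt K (k.2 - m.2.2))

/-- membership in M[[𝐳₁,…,𝐳ᵣ]] -/
def IsPowN {r : ℕ} (a : DistN K M r) : Prop :=
  ∀ n, a n ≠ 0 → ∀ i, IsNegInt K (n i).1 ∧ IsNegInt K (n i).2

/-- membership in M⌊𝐳₁,…,𝐳ᵣ⌋ -/
def InLatN {r : ℕ} (a : DistN K M r) : Prop :=
  ∃ S : Finset (Fin r → Idx K), ∀ n, a n ≠ 0 →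
    ∃ m ∈ S, ∀ i, IsNegInt K ((n i).1 - (m i).1) ∧ IsNegInt K ((n i).2 - (m i).2)

/-- ∂_z -/
def dz (a : Dist1 K M) : Dist1 K M := fun n => (-n.1) • a (n.1 - 1, n.2)

/-- ∂_z̄ -/
def dzb (a : Dist1 K M) : Dist1 K M := fun n => (-n.2) • a (n.1, n.2 - 1)

/-- ∂ in the first variable pair of a two-variable distribution (z-component) -/
def d1z (c : Dist2 K M) : Dist2 K M := fun n k => (-n.1) • c (n.1 - 1, n.2) k

/-- ∂ in the first variable pair of a two-variable distribution (z̄-component) -/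
def d1zb (c : Dist2 K M) : Dist2 K M := fun n k => (-n.2) • c (n.1, n.2 - 1) k

/-- divided power d^{(x)} of an operator d, for a K-valued exponent x
(zero unless x ∈ ℕ) -/
def dPow {A : Type*} [AddCommGroup A] [Module K A] (d : A → A) (x : K) (a : A) : A :=
  if h : ∃ j : ℕ, (j : K) = x then ((h.choose.factorial : K))⁻¹ • d^[h.choose] a else 0

/-- ∂_z^{(e_1)} ∂_z̄^{(e_2)} in the first variable pair -/
def ddPow2 (e : Idx K) (c : Dist2 K M) : Dist2 K M :=
  dPow K (d1z K M) e.1 (dPow K (d1zb K M) e.2 c)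

/-- the diagonal map c(𝐳,𝐰) ↦ c(𝐰,𝐰) -/
def diag (c : Dist2 K M) : Dist1 K M :=
  fun n => ∑ᶠ m : Idx K, c m (n.1 - m.1 - 1, n.2 - m.2 - 1)

/-- multiplication by (𝐳−𝐰)^h (expansion in z>w), on coefficients;
first index is 𝐳, second is 𝐰 -/
def zwPow (h : Idx K) (c : Dist2 K M) : Dist2 K M :=
  fun m k => ∑ᶠ i : ℕ × ℕ,
    ((-1 : K) ^ (i.1 + i.2) * gchoose K h.1 i.1 * gchoose K h.2 i.2) •
      c (m.1 + h.1 - i.1, m.2 + h.2 - i.2) (k.1 + i.1, k.2 + i.2)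

/-- multiplication by ((𝐳−𝐰)_{w>z})^h = (−1)^h (𝐰−𝐳)^h (expansion in w>z) -/
def zwPowW (h : Idx K) (c : Dist2 K M) : Dist2 K M :=
  fun m k => ∑ᶠ i : ℕ × ℕ,
    (negOnePow K (h.1 - h.2) * (-1 : K) ^ (i.1 + i.2) *
        gchoose K h.1 i.1 * gchoose K h.2 i.2) •
      c (m.1 + i.1, m.2 + i.2) (k.1 + h.1 - i.1, k.2 + h.2 - i.2)

/-- multiplication by (𝐱+𝐰)^N of a distribution d(𝐰,𝐱) (first index 𝐰, second 𝐱);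
the result is indexed by (x-index, w-index) -/
def xwPow (N : Idx K) (d : Dist2 K M) : Dist2 K M :=
  fun m k => ∑ᶠ i : ℕ × ℕ, (gchoose K N.1 i.1 * gchoose K N.2 i.2) •
    d (k.1 + i.1, k.2 + i.2) (m.1 + N.1 - i.1, m.2 + N.2 - i.2)

/-- multiplication by (𝐰+𝐱)^N of a distribution d(𝐰,𝐱) (first index 𝐰, second 𝐱);
the result is indexed by (x-index, w-index) -/
def wxPow (N : Idx K) (d : Dist2 K M) : Dist2 K M :=
  fun m k => ∑ᶠ i : ℕ × ℕ, (gchoose K N.1 i.1 * gchoose K N.2 i.2) •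
    d (k.1 + N.1 - i.1, k.2 + N.2 - i.2) (m.1 + i.1, m.2 + i.2)

/-- multiplication by 𝐱^A 𝐰^B (𝐱+𝐰)^N of p(𝐰,𝐱); result indexed (x-index, w-index) -/
def tripleXW (A B N : Idx K) (p : Dist2 K M) : Dist2 K M :=
  fun m k => ∑ᶠ l : ℕ × ℕ, (gchoose K N.1 l.1 * gchoose K N.2 l.2) •
    p (k.1 + B.1 + l.1, k.2 + B.2 + l.2) (m.1 + A.1 + N.1 - l.1, m.2 + A.2 + N.2 - l.2)

/-- multiplication by 𝐱^A 𝐰^B (𝐰+𝐱)^N of p(𝐰,𝐱); result indexed (x-index, w-index) -/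
def tripleWX (A B N : Idx K) (p : Dist2 K M) : Dist2 K M :=
  fun m k => ∑ᶠ l : ℕ × ℕ, (gchoose K N.1 l.1 * gchoose K N.2 l.2) •
    p (k.1 + B.1 + N.1 - l.1, k.2 + B.2 + N.2 - l.2) (m.1 + A.1 + l.1, m.2 + A.2 + l.2)

variable (E : Type*) [AddCommGroup E] [Module K E]

/-- End(E)-valued distributions in one variable pair -/
abbrev EDist1 := Dist1 K (Module.End K E)

/-- End(E)-valued distributions in two variable pairs -/
abbrev EDist2 := Dist2 K (Module.End K E)

/-- End(E)-valued distributions in r variable pairs -/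
abbrev EDistN (r : ℕ) := DistN K (Module.End K E) r

def ev1 (a : EDist1 K E) (v : E) : Dist1 K E := fun n => a n v

def ev2 (c : EDist2 K E) (v : E) : Dist2 K E := fun n k => c n k v

def evN {r : ℕ} (c : EDistN K E r) (v : E) : DistN K E r := fun n => c n v

/-- a(𝐳) is a field -/
def IsFieldD (a : EDist1 K E) : Prop := ∀ v, InLat1 K E (ev1 K E a v)

/-- a field in two variable pairs -/
def IsField2D (c : EDist2 K E) : Prop := ∀ v, InLat2 K E (ev2 K E c v)

/-- the Koszul sign (−1)^{pq} -/
def koszul (p q : ZMod 2) : K := if p = 1 ∧ q = 1 then (-1 : K) else 1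

/-- the data (c^i, 𝐡_i) is an OPE of the homogeneous distributions a(𝐳), b(𝐳)
of parities pa, pb (all identities to be read applied to each vector of E) -/
def IsOPE (pa pb : ZMod 2) (a b : EDist1 K E) {r : ℕ}
    (c : Fin r → EDist2 K E) (h : Fin r → Idx K) : Prop :=
  (∀ i, Kbar K (h i)) ∧ (∀ i, IsField2D K E (c i)) ∧
  (∀ v m k, a m (b k v) = ∑ i, zwPow K E (-(h i)) (ev2 K E (c i) v) m k) ∧
  (∀ v m k, koszul K pa pb • (b k (a m v)) =
      ∑ i, zwPowW K E (-(h i)) (ev2 K E (c i) v) m k)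

/-- a(𝐳), b(𝐳) (homogeneous of parities pa, pb) are local -/
def IsLocal (pa pb : ZMod 2) (a b : EDist1 K E) : Prop :=
  ∃ (r : ℕ) (c : Fin r → EDist2 K E) (h : Fin r → Idx K), IsOPE K E pa pb a b c h

/-- the exponents of an OPE are reduced: 𝐡_i ∉ 𝐡_j + ℤ² for i ≠ j -/
def ReducedExp {r : ℕ} (h : Fin r → Idx K) : Prop :=
  ∀ i j, i ≠ j → ¬ IsIntPair K (h i - h j)

/-- the product field a(𝐰)_{(𝐧)}b(𝐰) built from an OPE (c,h), applied to a vector v -/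
def prodAt {r : ℕ} (c : Fin r → EDist2 K E) (h : Fin r → Idx K) (n : Idx K)
    (v : E) : Dist1 K E :=
  fun m => ∑ i, diag K E
    (ddPow2 K E ((h i).1 - 1 - n.1, (h i).2 - 1 - n.2) (ev2 K E (c i) v)) m

/-- s₁ : a(𝐳) ↦ a_{(−1,−1)}1 -/
def s1 (one : E) (a : EDist1 K E) : E := a ((-1 : K), (-1 : K)) one

/-- the distribution d (to be thought of as a(𝐳)1) equals
Σ_{𝐢∈ℕ²} T^{(i)} T̄^{(ī)} (d_{(−1,−1)}) 𝐳^𝐢, i.e. a(𝐳) is creative -/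
def CreativeD (T Tb : Module.End K E) (d : Dist1 K E) : Prop :=
  (∀ i : ℕ × ℕ, d (-(i.1 : K) - 1, -(i.2 : K) - 1) =
      ((i.1.factorial : K)⁻¹ * (i.2.factorial : K)⁻¹) •
        ((T ^ i.1) * (Tb ^ i.2)) (d ((-1 : K), (-1 : K)))) ∧
  (∀ n : Idx K, (¬ ∃ i : ℕ × ℕ, n = (-(i.1 : K) - 1, -(i.2 : K) - 1)) → d n = 0)

/-- a(𝐳) is translation covariant for (T, T̄) -/
def TransCov (T Tb : Module.End K E) (a : EDist1 K E) : Prop :=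
  (∀ n : Idx K, T * a n - a n * T = (-n.1) • a (n.1 - 1, n.2)) ∧
  (∀ n : Idx K, Tb * a n - a n * Tb = (-n.2) • a (n.1, n.2 - 1))

/-- translation covariance of a product field, per vector -/
def TransCovAt (T Tb : Module.End K E) (P : E → Dist1 K E) : Prop :=
  (∀ v (m : Idx K), T (P v m) - P (T v) m = (-m.1) • P v (m.1 - 1, m.2)) ∧
  (∀ v (m : Idx K), Tb (P v m) - P (Tb v) m = (-m.2) • P v (m.1, m.2 - 1))

/-- the identity field 1(z) = id_E -/
def idField : EDist1 K E :=
  fun n => if n = ((-1 : K), (-1 : K)) then (1 : Module.End K E) else 0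

/-- pairs i < j in [r] -/
abbrev Pairs (r : ℕ) := {p : Fin r × Fin r // p.1 < p.2}

/-- the index shift of the i-th variable produced by the monomial of a binomial
expansion of ((𝐳_{p₁} − 𝐳_{p₂})_σ)^h belonging to 𝐤 ∈ ℕ² -/
def pairShift {r : ℕ} (p : Pairs r) (h : Idx K) (flip : Bool) (kk : ℕ × ℕ)
    (i : Fin r) : Idx K :=
  if i = p.1.1 then
    (if flip then ((kk.1 : K), (kk.2 : K)) else (h.1 - kk.1, h.2 - kk.2))
  else if i = p.1.2 then
    (if flip then (h.1 - kk.1, h.2 - kk.2) else ((kk.1 : K), (kk.2 : K)))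
  else 0

/-- the coefficient of a binomial expansion of ((𝐳_{p₁} − 𝐳_{p₂})_σ)^h
belonging to 𝐤 ∈ ℕ² -/
def pairCoef (h : Idx K) (flip : Bool) (kk : ℕ × ℕ) : K :=
  (if flip then negOnePow K (h.1 - h.2) else 1) * (-1 : K) ^ (kk.1 + kk.2) *
    gchoose K h.1 kk.1 * gchoose K h.2 kk.2

def flipOf {r : ℕ} (σ : Equiv.Perm (Fin r)) (p : Pairs r) : Bool :=
  decide (σ.symm p.1.2 < σ.symm p.1.1)

/-- multiplication by Π_{i<j} ((𝐳_i − 𝐳_j)_σ)^{h_{ij}} on an r-variable distribution -/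
def permMul {r : ℕ} (σ : Equiv.Perm (Fin r)) (hs : Pairs r → Idx K)
    (c : DistN K M r) : DistN K M r :=
  fun m => ∑ᶠ κ : Pairs r → ℕ × ℕ,
    (∏ p : Pairs r, pairCoef K (hs p) (flipOf σ p) (κ p)) •
      c (fun i => m i + ∑ p : Pairs r, pairShift K p (hs p) (flipOf σ p) (κ p) i)

/-- the Koszul sign ζ' produced by reordering a¹,…,aʳ into a^{σ1},…,a^{σr} -/
def koszulPerm {r : ℕ} (ps : Fin r → ZMod 2) (σ : Equiv.Perm (Fin r)) : K :=
  ∏ p : Pairs r,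
    if σ.symm p.1.2 < σ.symm p.1.1 ∧ ps p.1.1 = 1 ∧ ps p.1.2 = 1 then (-1 : K) else 1

/-- the composition a^{σ1}(𝐳_{σ1})_{m_{σ1}} ∘ ⋯ ∘ a^{σr}(𝐳_{σr})_{m_{σr}} applied to v -/
def compSeq {r : ℕ} (a : Fin r → EDist1 K E) (σ : Equiv.Perm (Fin r))
    (m : Fin r → Idx K) (v : E) : E :=
  (List.ofFn fun j : Fin r => σ j).foldr (fun i acc => a i (m i) acc) v

/-- the data (c^α, 𝐡_{ij}^k) is a (multiple) OPE of the homogeneous distributions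
a¹(𝐳),…,aʳ(𝐳) of parities ps -/
def IsMultOPE {r : ℕ} (a : Fin r → EDist1 K E) (ps : Fin r → ZMod 2)
    (rij : Fin r → Fin r → ℕ) (hs : ∀ i j : Fin r, Fin (rij i j) → Idx K)
    (c : ((p : Pairs r) → Fin (rij p.1.1 p.1.2)) → EDistN K E r) : Prop :=
  (∀ i j k, Kbar K (hs i j k)) ∧
  (∀ α v, InLatN K E (evN K E (c α) v)) ∧
  (∀ σ : Equiv.Perm (Fin r), ∀ v m,
    koszulPerm K ps σ • compSeq K E a σ m v =
      ∑ α : (p : Pairs r) → Fin (rij p.1.1 p.1.2),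
        permMul K E σ (fun p => -(hs p.1.1 p.1.2 (α p))) (evN K E (c α) v) m)

/-- a¹(𝐳),…,aʳ(𝐳) are multiply local -/
def MultiplyLocal {r : ℕ} (a : Fin r → EDist1 K E) (ps : Fin r → ZMod 2) : Prop :=
  ∃ (rij : Fin r → Fin r → ℕ) (hs : ∀ i j : Fin r, Fin (rij i j) → Idx K)
    (c : ((p : Pairs r) → Fin (rij p.1.1 p.1.2)) → EDistN K E r),
      IsMultOPE K E a ps rij hs c

/-- a set of homogeneous fields (with parities pF) is multiply local -/
def MultLocalSet (F : Set (EDist1 K E)) (pF : EDist1 K E → ZMod 2) : Prop :=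
  ∀ (r : ℕ) (f : Fin r → EDist1 K E), (∀ i, f i ∈ F) →
    MultiplyLocal K E f (fun i => pF (f i))

/-- a set of homogeneous fields (with parities pF) is uniformly local -/
def UnifLocalSet (F : Set (EDist1 K E)) (pF : EDist1 K E → ZMod 2) (one : E) : Prop :=
  ∃ (rr : EDist1 K E → EDist1 K E → ℕ)
    (hh : ∀ d e : EDist1 K E, Fin (rr d e) → Idx K),
    ∀ (r : ℕ) (f : Fin r → EDist1 K E), (∀ i, f i ∈ F) →
      ∃ c, IsMultOPE K E f (fun i => pF (f i)) (fun i j => rr (f i) (f j))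
          (fun i j => hh (f i) (f j)) c ∧
        ∀ α, IsPowN K E (evN K E (c α) one)

/-- a ∈ V is homogeneous of parity p w.r.t. the grading (ev, od) -/
def memPar {V : Type*} [AddCommGroup V] [Module K V] (ev od : Submodule K V)
    (a : V) (p : ZMod 2) : Prop :=
  (p = 0 ∧ a ∈ ev) ∨ (p = 1 ∧ a ∈ od)

/-- an endomorphism is homogeneous of parity p w.r.t. the grading (ev, od) -/
def EndPar {V : Type*} [AddCommGroup V] [Module K V] (ev od : Submodule K V)
    (f : Module.End K V) (p : ZMod 2) : Prop :=
  if p = 0 then (∀ v ∈ ev, f v ∈ ev) ∧ (∀ v ∈ od, f v ∈ od)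
  else (∀ v ∈ ev, f v ∈ od) ∧ (∀ v ∈ od, f v ∈ ev)

/-- a distribution is homogeneous of parity p -/
def EDistPar {V : Type*} [AddCommGroup V] [Module K V] (ev od : Submodule K V)
    (a : EDist1 K V) (p : ZMod 2) : Prop :=
  ∀ n, EndPar K ev od (a n) p

end OPEA

namespace OPEA

/-- an OPE-algebra -/
structure OPEAlg (K : Type*) [Field K] [CharZero K]
    (V : Type*) [AddCommGroup V] [Module K V] where
  ev : Submodule K V
  od : Submodule K V
  compl : IsCompl ev od
  Y : V →ₗ[K] EDist1 K V
  Y_par : ∀ a p, memPar K ev od a p → ∀ (n : Idx K) b q, memPar K ev od b q →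
    memPar K ev od (Y a n b) (p + q)
  one : V
  one_ev : one ∈ ev
  T : Module.End K V
  Tb : Module.End K V
  T_ev : EndPar K ev od T 0
  Tb_ev : EndPar K ev od Tb 0
  commTTb : T * Tb = Tb * T
  T_one : T one = 0
  Tb_one : Tb one = 0
  wcre : ∀ a, IsPow1 K V (ev1 K V (Y a) one)
  rid : ∀ a, Y a ((-1 : K), (-1 : K)) one = a
  tcov : ∀ a, TransCov K V T Tb (Y a)
  loc : ∀ a b pa pb, memPar K ev od a pa → memPar K ev od b pb →
    IsLocal K V pa pb (Y a) (Y b)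

/-- a bounded 𝕂̄-fold algebra -/
structure BFold (K : Type*) [Field K] [CharZero K]
    (V : Type*) [AddCommGroup V] [Module K V] where
  ev : Submodule K V
  od : Submodule K V
  compl : IsCompl ev od
  Y : V →ₗ[K] EDist1 K V
  Y_par : ∀ a p, memPar K ev od a p → ∀ (n : Idx K) b q, memPar K ev od b q →
    memPar K ev od (Y a n b) (p + q)
  fields : ∀ a, IsFieldD K V (Y a)
  bounded : ∀ a (n : Idx K), ¬ Kbar K n → ∀ b, Y a n b = 0

/-- a bounded 𝕂̄-fold module over a bounded 𝕂̄-fold algebra -/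
structure BMod (K : Type*) [Field K] [CharZero K]
    (V : Type*) [AddCommGroup V] [Module K V] (A : BFold K V)
    (Mo : Type*) [AddCommGroup Mo] [Module K Mo] where
  evM : Submodule K Mo
  odM : Submodule K Mo
  complM : IsCompl evM odM
  YM : V →ₗ[K] EDist1 K Mo
  YM_par : ∀ a p, memPar K A.ev A.od a p → ∀ n : Idx K, EndPar K evM odM (YM a n) p
  fieldsM : ∀ a, IsFieldD K Mo (YM a)
  boundedM : ∀ a (n : Idx K), ¬ Kbar K n → ∀ c, YM a n c = 0

variable (K : Type*) [Field K] [CharZero K]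
variable (V : Type*) [AddCommGroup V] [Module K V]
variable (Mo : Type*) [AddCommGroup Mo] [Module K Mo]

/-- the operator T₁ : a ↦ a_{(−2,−1)}1 of an OPE-algebra -/
def T1 (A : OPEAlg K V) : Module.End K V where
  toFun := fun a => A.Y a ((-2 : K), (-1 : K)) A.one
  map_add' := by
    intro x y
    simp [map_add, Pi.add_apply, LinearMap.add_apply]
  map_smul' := by
    intro c x
    simp [map_smul, Pi.smul_apply, LinearMap.smul_apply]

/-- the operator T̄₁ : a ↦ a_{(−1,−2)}1 of an OPE-algebra -/
def T1b (A : OPEAlg K V) : Module.End K V where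
  toFun := fun a => A.Y a ((-1 : K), (-2 : K)) A.one
  map_add' := by
    intro x y
    simp [map_add, Pi.add_apply, LinearMap.add_apply]
  map_smul' := by
    intro c x
    simp [map_smul, Pi.smul_apply, LinearMap.smul_apply]

/-- skew-symmetry for the pair (T, T̄) -/
def SkewSym (ev od : Submodule K V) (Yf : V → EDist1 K V)
    (T Tb : Module.End K V) : Prop :=
  ∀ a b pa pb, memPar K ev od a pa → memPar K ev od b pb →
    ∀ n : Idx K, Kbar K n →
      (Function.support (fun i : ℕ × ℕ =>
        ((i.1.factorial : K)⁻¹ * (i.2.factorial : K)⁻¹ *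
            negOnePow K (n.1 + i.1 - (n.2 + i.2))) •
          ((T ^ i.1) * (Tb ^ i.2)) (Yf a (n.1 + i.1, n.2 + i.2) b))).Finite ∧
      koszul K pa pb • Yf b n a =
        ∑ᶠ i : ℕ × ℕ, ((i.1.factorial : K)⁻¹ * (i.2.factorial : K)⁻¹ *
            negOnePow K (n.1 + i.1 - (n.2 + i.2))) •
          ((T ^ i.1) * (Tb ^ i.2)) (Yf a (n.1 + i.1, n.2 + i.2) b)

/-- (T, T̄) is a translation endomorphism of the module with state-field map YM -/
def TransEnd (YM : V → EDist1 K Mo) (T Tb : Module.End K V) : Prop :=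
  (∀ a (n : Idx K), YM (T a) n = (-n.1) • YM a (n.1 - 1, n.2)) ∧
  (∀ a (n : Idx K), YM (Tb a) n = (-n.2) • YM a (n.1, n.2 - 1))

/-- the coefficient at (x-index m, w-index k) of a(𝐱+𝐰) applied to the w-distribution bw -/
def lhsXW (YM : V → EDist1 K Mo) (a : V) (bw : Dist1 K Mo) (m k : Idx K) : Mo :=
  ∑ᶠ i : ℕ × ℕ, ((i.1.factorial : K)⁻¹ * (i.2.factorial : K)⁻¹) •
    (((dz K (Module.End K Mo))^[i.1] ((dzb K (Module.End K Mo))^[i.2] (YM a))) m)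
      (bw (k.1 + i.1, k.2 + i.2))

/-- a and cM are dual in the direct channel -/
def DualDirect (Y : V → EDist1 K V) (YM : V → EDist1 K Mo) (a : V) (cM : Mo) : Prop :=
  ∃ (s : ℕ) (d : Fin s → Idx K → Idx K → (V →ₗ[K] Mo)) (hj : Fin s → Idx K),
    (∀ j, Kbar K (hj j)) ∧
    (∀ j b, InLat2 K Mo (fun kw mx => d j kw mx b)) ∧
    (∀ b (m k : Idx K),
      lhsXW K V Mo YM a (fun k' => YM b k' cM) m k =
        ∑ j, xwPow K Mo (-(hj j)) (fun kw mx => d j kw mx b) m k) ∧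
    (∀ b (m k : Idx K),
      YM (Y a m b) k cM =
        ∑ j, wxPow K Mo (-(hj j)) (fun kw mx => d j kw mx b) m k)

/-- a and b are dual in the exchange channel on the module -/
def DualExch (Y : V → EDist1 K V) (YM : V → EDist1 K Mo) (a b : V) : Prop :=
  ∃ (r : ℕ) (hab : Fin r → Idx K), (∀ i, Kbar K (hab i)) ∧
    ∀ cM : Mo, ∃ (s : ℕ) (hac : Fin s → Idx K)
      (q : Fin r → Fin s → Idx K → Idx K → Mo),
      (∀ j, Kbar K (hac j)) ∧
      (∀ i j kw mx, q i j kw mx ≠ 0 → IsNegInt K mx.1 ∧ IsNegInt K mx.2) ∧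
      (∀ i j mx, InLat1 K Mo (fun kw => q i j kw mx)) ∧
      (∀ m k : Idx K,
        lhsXW K V Mo YM a (fun k' => YM b k' cM) m k =
          ∑ j, xwPow K Mo (-(hac j))
            (fun kw mx => ∑ i, q i j kw (mx.1 - (hab i).1, mx.2 - (hab i).2)) m k) ∧
      (∀ m k : Idx K,
        YM (Y a m b) k cM =
          ∑ j, wxPow K Mo (-(hac j))
            (fun kw mx => ∑ i, q i j kw (mx.1 - (hab i).1, mx.2 - (hab i).2)) m k)

/-- the module with state-field map YM is dual -/
def IsDualMod (ev od : Submodule K V) (Y : V → EDist1 K V) (YM : V → EDist1 K Mo) : Prop :=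
  ∃ (rVV : V → V → ℕ) (hVV : ∀ a b : V, Fin (rVV a b) → Idx K)
    (rVM : V → Mo → ℕ) (hVM : ∀ (a : V) (c : Mo), Fin (rVM a c) → Idx K),
    (∀ a b i, Kbar K (hVV a b i)) ∧ (∀ a c j, Kbar K (hVM a c j)) ∧
    ∀ a b pa pb, memPar K ev od a pa → memPar K ev od b pb → ∀ c : Mo,
      ∃ p : Fin (rVV a b) → Fin (rVM a c) → Fin (rVM b c) → Dist2 K Mo,
        (∀ i j k, IsPow2 K Mo (p i j k)) ∧
        (∀ m k : Idx K,
          lhsXW K V Mo YM a (fun k' => YM b k' c) m k =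
            ∑ i, ∑ j, ∑ kk, tripleXW K Mo (-(hVV a b i)) (-(hVM b c kk))
              (-(hVM a c j)) (p i j kk) m k) ∧
        (∀ m k : Idx K,
          YM (Y a m b) k c =
            ∑ i, ∑ j, ∑ kk, tripleWX K Mo (-(hVV a b i)) (-(hVM b c kk))
              (-(hVM a c j)) (p i j kk) m k)

/-- F_Y is multiply local -/
def MultLocalAlg (A : OPEAlg K V) : Prop :=
  ∀ (r : ℕ) (f : Fin r → V) (pf : Fin r → ZMod 2),
    (∀ i, memPar K A.ev A.od (f i) (pf i)) →
      MultiplyLocal K V (fun i => A.Y (f i)) pf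

/-- F_Y is uniformly local -/
def UnifLocalAlg (A : OPEAlg K V) : Prop :=
  ∃ (rr : V → V → ℕ) (hh : ∀ a b : V, Fin (rr a b) → Idx K),
    ∀ (r : ℕ) (f : Fin r → V) (pf : Fin r → ZMod 2),
      (∀ i, memPar K A.ev A.od (f i) (pf i)) →
        ∃ c, IsMultOPE K V (fun i => A.Y (f i)) pf (fun i j => rr (f i) (f j))
            (fun i j => hh (f i) (f j)) c ∧
          ∀ α, IsPowN K V (evN K V (c α) A.one)

end OPEA
namespace OPEA

/-- the formal power series `(1 - X)^x` -/
def oneSubPow (K : Type*) [Field K] (x : K) : PowerSeries K :=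
  PowerSeries.mk fun n => (-1) ^ n * gchoose K x n

/-- the Euler operator `t ∂_t` in the coordinate `t = 1 - X` -/
def eulerOneSub (K : Type*) [Field K] : Module.End K (PowerSeries K) where
  toFun f := (PowerSeries.X - 1) * PowerSeries.derivative K f
  map_add' f g := by rw [map_add, mul_add]
  map_smul' a f := by rw [Derivation.map_smul, mul_smul_comm, RingHom.id_apply]

theorem gchoose_zero (K : Type*) [Field K] (x : K) : gchoose K x 0 = 1 := by
  simp [gchoose]

theorem succ_mul_gchoose_succ (K : Type*) [Field K] [CharZero K] (x : K) (n : ℕ) :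
    ((n : K) + 1) * gchoose K x (n + 1) = (x - n) * gchoose K x n := by
  have h1 : (n.factorial : K) ≠ 0 := Nat.cast_ne_zero.2 n.factorial_ne_zero
  have h2 : (n : K) + 1 ≠ 0 := Nat.cast_add_one_ne_zero n
  simp only [gchoose, Finset.prod_range_succ, Nat.factorial_succ, Nat.cast_mul, Nat.cast_succ]
  field_simp

theorem oneSubPow_ne_zero (K : Type*) [Field K] (x : K) : oneSubPow K x ≠ 0 := by
  intro h
  have := congrArg (PowerSeries.coeff 0) h
  simp [oneSubPow, gchoose_zero] at this

theorem derivative_oneSubPow (K : Type*) [Field K] [CharZero K] (x : K) :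
    (PowerSeries.X - 1) * PowerSeries.derivative K (oneSubPow K x) = x • oneSubPow K x := by
  ext n
  have key := succ_mul_gchoose_succ K x n
  cases n with
  | zero =>
    rw [sub_mul, one_mul, map_sub, PowerSeries.coeff_zero_X_mul, PowerSeries.coeff_derivative]
    simpa [oneSubPow, gchoose_zero] using key
  | succ n =>
    simp only [sub_mul, one_mul, map_sub, PowerSeries.coeff_succ_X_mul,
      PowerSeries.coeff_derivative, oneSubPow, PowerSeries.coeff_mk, PowerSeries.coeff_smul,
      smul_eq_mul, Nat.cast_succ] at key ⊢
    linear_combination (-1) ^ (n + 1) * key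

theorem eulerOneSub_hasEigenvector (K : Type*) [Field K] [CharZero K] (x : K) (j : ℕ) :
    (eulerOneSub K).HasEigenvector (x + j) ((1 - PowerSeries.X) ^ j * oneSubPow K x) := by
  rw [Module.End.hasEigenvector_iff, Module.End.mem_eigenspace_iff]
  refine ⟨?_, mul_ne_zero (pow_ne_zero _ ?_) (oneSubPow_ne_zero K x)⟩
  · have h := derivative_oneSubPow K x
    have h1 : PowerSeries.derivative K (1 - PowerSeries.X : PowerSeries K) = -1 := by
      rw [map_sub, PowerSeries.derivative_X]
      simp
    simp only [eulerOneSub, LinearMap.coe_mk, AddHom.coe_mk, Derivation.leibniz,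
      Derivation.leibniz_pow, h1, smul_eq_mul, nsmul_eq_mul]
    rw [add_smul, ← mul_smul_comm x, ← h, Nat.cast_smul_eq_nsmul, nsmul_eq_mul]
    cases j with
    | zero => simp
    | succ j => simp; ring
  · intro h
    have := congrArg (PowerSeries.coeff 0) h
    simp at this

/-- powers `(1 - X)^x` with exponents distinct modulo `ℤ` are independent over polynomials -/
theorem eq_zero_of_sum_polynomial_mul_oneSubPow {K ι : Type*} [Field K] [CharZero K] [Fintype ι]
    (α : ι → K) (hα : ∀ i j, i ≠ j → ¬ IsInt K (α i - α j)) (p : ι → Polynomial K)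
    (h : ∑ i, (p i : PowerSeries K) * oneSubPow K (α i) = 0) (i : ι) : p i = 0 := by
  have hli : LinearIndependent K fun x : ι × ℕ =>
      (1 - PowerSeries.X) ^ x.2 * oneSubPow K (α x.1) := by
    refine Module.End.eigenvectors_linearIndependent' (eulerOneSub K)
      (fun x : ι × ℕ => α x.1 + x.2) ?_ _ fun x => eulerOneSub_hasEigenvector K _ _
    rintro ⟨i, s⟩ ⟨j, t⟩ hst
    by_cases hij : i = j
    · subst hij
      simpa using hst
    · refine absurd ⟨(t : ℤ) - s, ?_⟩ (hα i j hij)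
      push_cast
      linear_combination -hst
  set q : ι → Polynomial K := fun i => (p i).comp (1 - Polynomial.X) with hq
  have hpq : ∀ i, p i = (q i).comp (1 - Polynomial.X) := fun i => by
    simp [hq, Polynomial.comp_assoc]
  obtain ⟨B, hB⟩ : ∃ B, ∀ i, (q i).natDegree < B :=
    ⟨(Finset.univ.sup fun i => (q i).natDegree) + 1, fun i =>
      Nat.lt_succ_of_le (Finset.le_sup (f := fun i => (q i).natDegree) (Finset.mem_univ i))⟩
  have hexp : ∀ i, (p i : PowerSeries K) =
      ∑ j ∈ Finset.range B, (q i).coeff j • (1 - PowerSeries.X) ^ j := fun i => by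
    rw [hpq i, Polynomial.comp, Polynomial.eval₂_eq_sum_range' _ (hB i)]
    rw [← Polynomial.coeToPowerSeries.ringHom_apply, map_sum]
    refine Finset.sum_congr rfl fun j _ => ?_
    simp [PowerSeries.smul_eq_C_mul]
  have hq0 : ∀ i, q i = 0 := fun i => by
    ext j
    by_cases hj : j < B
    · refine linearIndependent_iff'.1 hli (Finset.univ ×ˢ Finset.range B)
        (fun x => (q x.1).coeff x.2) ?_ (i, j) (by simpa using hj)
      rw [Finset.sum_product, ← h]
      refine Finset.sum_congr rfl fun i _ => ?_
      rw [hexp, Finset.sum_mul]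
      simp only [smul_mul_assoc]
    · exact Polynomial.coeff_eq_zero_of_natDegree_lt ((hB i).trans_le (not_lt.1 hj))
  rw [hpq, hq0, Polynomial.zero_comp]

/-- triangular elimination in the second variable, after separating the exponents in the first -/
theorem eq_zero_of_sum_convolution {K ι E : Type*} [Field K] [CharZero K] [Fintype ι]
    [AddCommGroup E] [Module K E]
    (α : ι → K) (hα : ∀ i j, i ≠ j → ¬ IsInt K (α i - α j))
    (β : ι → ℕ → K) (hβ : ∀ i, β i 0 ≠ 0) (x : ι → ℕ → ℕ → E) (N : ℕ)
    (hx : ∀ i p q, N ≤ p → x i p q = 0)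
    (h : ∀ l l' : ℕ, ∑ i, ∑ s ∈ Finset.range (l + 1), ∑ t ∈ Finset.range (l' + 1),
      ((-1) ^ s * gchoose K (α i) s * β i t) • x i (l - s) (l' - t) = 0)
    (i : ι) (p q : ℕ) : x i p q = 0 := by
  rw [← Module.forall_dual_apply_eq_zero_iff K]
  intro φ
  set P : ι → ℕ → Polynomial K := fun i q =>
    ∑ p ∈ Finset.range N, Polynomial.monomial p (φ (x i p q)) with hP
  have hcoeff : ∀ i q p, (P i q).coeff p = φ (x i p q) := fun i q p => by
    simp only [hP, Polynomial.finsetSum_coeff, Polynomial.coeff_monomial]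
    rw [Finset.sum_ite_eq']
    split_ifs with hp
    · rfl
    · rw [hx i p q (by simpa using hp), map_zero]
  have hsum : ∀ i l', ∑ t ∈ Finset.range (l' + 1), Polynomial.C (β i t) * P i (l' - t) = 0 := by
    intro i l'
    refine eq_zero_of_sum_polynomial_mul_oneSubPow α hα
      (fun i => ∑ t ∈ Finset.range (l' + 1), Polynomial.C (β i t) * P i (l' - t)) ?_ i
    ext l
    have := congrArg φ (h l l')
    rw [map_zero, map_sum] at this
    rw [map_zero, map_sum, ← this]
    refine Finset.sum_congr rfl fun i _ => ?_
    rw [mul_comm, PowerSeries.coeff_mul, Finset.Nat.sum_antidiagonal_eq_sum_range_succ_mk, map_sum]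
    refine Finset.sum_congr rfl fun s _ => ?_
    simp only [oneSubPow, PowerSeries.coeff_mk, Polynomial.coeff_coe, Polynomial.finsetSum_coeff,
      Polynomial.coeff_C_mul, hcoeff, map_sum, map_smul, smul_eq_mul, Finset.mul_sum]
    exact Finset.sum_congr rfl fun t _ => by ring
  have hP0 : ∀ q, P i q = 0 := by
    intro q
    induction q using Nat.strong_induction_on with
    | _ q ih =>
      have := hsum i q
      rw [Finset.sum_range_succ', Finset.sum_eq_zero, zero_add, Nat.sub_zero] at this
      · simpa [hβ i] using this
      · intro t ht
        rw [ih _ (by have := Finset.mem_range.1 ht; omega), mul_zero]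
  rw [← hcoeff, hP0, Polynomial.coeff_zero]

theorem exists_bound_of_inLat2 {K E : Type*} [Field K] [CharZero K] [AddCommGroup E] [Module K E]
    (d : Dist2 K E) (hd : InLat2 K E d) (m k : Idx K) :
    ∃ N : ℕ, ∀ j : ℤ × ℤ, d (m.1 - j.1, m.2 - j.2) (k.1 + j.1, k.2 + j.2) ≠ 0 →
      j.1.natAbs ≤ N ∧ j.2.natAbs ≤ N := by
  have one : ∀ x y : K, ∃ N : ℕ, ∀ j : ℤ, IsNegInt K (x - j) → IsNegInt K (y + j) →
      j.natAbs ≤ N := by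
    intro x y
    by_cases hx : ∃ e : ℤ, (e : K) = x
    · by_cases hy : ∃ e : ℤ, (e : K) = y
      · obtain ⟨e, rfl⟩ := hx
        obtain ⟨e', rfl⟩ := hy
        refine ⟨e.natAbs + e'.natAbs, ?_⟩
        rintro j ⟨s, hs, hs'⟩ ⟨t, ht, ht'⟩
        norm_cast at hs' ht'
        omega
      · refine ⟨0, ?_⟩
        rintro j - ⟨t, -, ht⟩
        exact absurd ⟨t - j, by push_cast; rw [ht]; ring⟩ hy
    · refine ⟨0, ?_⟩
      rintro j ⟨t, -, ht⟩ -
      exact absurd ⟨t + j, by push_cast; rw [ht]; ring⟩ hx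
  choose f hf using one
  obtain ⟨S, hS⟩ := hd
  refine ⟨S.sup fun s => max (f (m.1 - s.1.1) (k.1 - s.2.1)) (f (m.2 - s.1.2) (k.2 - s.2.2)), ?_⟩
  intro j hj
  obtain ⟨s, hs, ⟨h1, h2⟩, h3, h4⟩ := hS _ _ hj
  have hle := Finset.le_sup
    (f := fun s => max (f (m.1 - s.1.1) (k.1 - s.2.1)) (f (m.2 - s.1.2) (k.2 - s.2.2))) hs
  refine ⟨(hf _ _ _ ?_ ?_).trans ((le_max_left _ _).trans hle),
    (hf _ _ _ ?_ ?_).trans ((le_max_right _ _).trans hle)⟩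
  · rwa [sub_right_comm]
  · rwa [sub_add_eq_add_sub]
  · rwa [sub_right_comm]
  · rwa [sub_add_eq_add_sub]

theorem not_isInt_sub_of_reduced {K : Type*} [Field K] [CharZero K] {r : ℕ} {h : Fin r → Idx K}
    (hK : ∀ i, Kbar K (h i)) (hred : ReducedExp K h) (i j : Fin r) (hij : i ≠ j) :
    ¬ IsInt K (-(h i).1 - -(h j).1) := by
  rintro ⟨n, hn⟩
  obtain ⟨s, hs⟩ := hK i
  obtain ⟨t, ht⟩ := hK j
  refine hred i j hij ⟨⟨-n, ?_⟩, -n - s + t, ?_⟩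
  · push_cast
    simp only [Prod.fst_sub]
    linear_combination -hn
  · push_cast
    simp only [Prod.snd_sub]
    linear_combination -hn - hs + ht

/-- if the expansion of `∑ (𝐳−𝐰)^{−𝐡_i} d_i` vanishes on a class of `𝐰`-exponents modulo `ℤ²`,
then so does every `d_i` -/
theorem eq_zero_of_sum_zwPow_eq_zero {K E : Type*} [Field K] [CharZero K] [AddCommGroup E]
    [Module K E] {r : ℕ} {h : Fin r → Idx K} (hK : ∀ i, Kbar K (h i)) (hred : ReducedExp K h)
    (d : Fin r → Dist2 K E) (hd : ∀ i, InLat2 K E (d i)) (k₀ : Idx K)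
    (h0 : ∀ m k, IsIntPair K (k - k₀) → ∑ i, zwPow K E (-(h i)) (d i) m k = 0)
    (i : Fin r) (m : Idx K) : d i m k₀ = 0 := by
  set μ : Fin r → Idx K := fun j => m + h i - h j with hμ
  choose f hf using fun j => exists_bound_of_inLat2 (d j) (hd j) (μ j) k₀
  obtain ⟨N, hN⟩ : ∃ N, ∀ j, f j ≤ N :=
    ⟨Finset.univ.sup f, fun j => Finset.le_sup (Finset.mem_univ j)⟩
  have hz : ∀ j (s t : ℤ), (N : ℤ) < s.natAbs ∨ (N : ℤ) < t.natAbs →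
      d j ((μ j).1 - s, (μ j).2 - t) (k₀.1 + s, k₀.2 + t) = 0 := by
    intro j s t hst
    by_contra hne
    have := hf j (s, t) hne
    have := hN j
    simp only at *
    omega
  set x : Fin r → ℕ → ℕ → E := fun j p q =>
    d j ((μ j).1 - ((N - p : ℤ) : K), (μ j).2 - ((N - q : ℤ) : K))
      (k₀.1 + ((N - p : ℤ) : K), k₀.2 + ((N - q : ℤ) : K)) with hx
  have key := eq_zero_of_sum_convolution (fun j => -(h j).1) (not_isInt_sub_of_reduced hK hred)
    (fun j t => (-1) ^ t * gchoose K (-(h j).2) t) (fun j => by simp [gchoose_zero]) x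
    (2 * N + 1) (fun j p q hp => hz j _ _ (by omega)) ?_ i N N
  · simpa [hx, hμ] using key
  intro l l'
  have := h0 (m.1 + (h i).1 - ((N - l : ℤ) : K), m.2 + (h i).2 - ((N - l' : ℤ) : K))
    (k₀.1 + ((N - l : ℤ) : K), k₀.2 + ((N - l' : ℤ) : K))
    ⟨⟨N - l, by simp⟩, ⟨N - l', by simp⟩⟩
  rw [← this]
  refine Finset.sum_congr rfl fun j _ => ?_
  rw [← Finset.sum_product', zwPow, finsum_eq_sum_of_support_subset]
  · refine Finset.sum_congr rfl fun st hst => ?_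
    obtain ⟨s, t⟩ := st
    simp only [Finset.mem_product, Finset.mem_range] at hst
    have h1 : ((N - (l - s : ℕ) : ℤ) : K) = ((N - l : ℤ) : K) + s := by
      rw [Nat.cast_sub (by omega)]
      push_cast
      ring
    have h2 : ((N - (l' - t : ℕ) : ℤ) : K) = ((N - l' : ℤ) : K) + t := by
      rw [Nat.cast_sub (by omega)]
      push_cast
      ring
    simp only [hx, hμ, h1, h2, Prod.fst_neg, Prod.snd_neg, Prod.fst_add, Prod.snd_add,
      Prod.fst_sub, Prod.snd_sub]
    congr 1
    · ring
    · congr 2 <;> ring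
  · rintro ⟨s, t⟩ hst
    by_contra hmem
    refine hst ?_
    simp only [Finset.coe_product, Finset.coe_range, Set.mem_prod, Set.mem_Iio] at hmem
    have := hz j (N - l + s) (N - l' + t) (by omega)
    simp only [hμ, Prod.fst_add, Prod.snd_add, Prod.fst_sub, Prod.snd_sub] at this
    push_cast at this
    convert smul_zero _ using 2
    rw [← this]
    simp only [Prod.fst_neg, Prod.snd_neg]
    push_cast
    congr 2 <;> ring

theorem negOnePow_ne_zero (K : Type*) [Field K] [CharZero K] (x : K) : negOnePow K x ≠ 0 := by
  unfold negOnePow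
  split_ifs
  · exact zpow_ne_zero _ (neg_ne_zero.2 one_ne_zero)
  · exact one_ne_zero

/-- the `w > z` expansion is the `z > w` expansion with the variables exchanged, up to a sign -/
theorem zwPowW_eq_zwPow_swap {K E : Type*} [Field K] [CharZero K] [AddCommGroup E] [Module K E]
    (h : Idx K) (d : Dist2 K E) (m k : Idx K) :
    zwPowW K E h d m k =
      zwPow K E h (fun n l => negOnePow K (h.1 - h.2) • d l n) k m := by
  refine finsum_congr fun i => ?_
  rw [smul_smul]
  congr 1
  ring

theorem InLat2.smul_swap {K E : Type*} [Field K] [CharZero K] [AddCommGroup E] [Module K E]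
    {d : Dist2 K E} (hd : InLat2 K E d) (ε : K) : InLat2 K E fun n l => ε • d l n := by
  obtain ⟨S, hS⟩ := hd
  refine ⟨S.image Prod.swap, fun n k hnk => ?_⟩
  obtain ⟨s, hs, h1, h2⟩ := hS k n (right_ne_zero_of_smul hnk)
  exact ⟨s.swap, Finset.mem_image_of_mem _ hs, h2, h1⟩

theorem IsIntPair.sub_comm {K : Type*} [Field K] [CharZero K] {m n : Idx K}
    (h : IsIntPair K (m - n)) : IsIntPair K (n - m) := by
  obtain ⟨⟨s, hs⟩, t, ht⟩ := h
  refine ⟨⟨-s, ?_⟩, -t, ?_⟩ <;> simp [hs, ht]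

/-- in a reduced OPE, the support of c^i(𝐳,𝐰)v projects into
supp(a(𝐳)v) + ℤ² in the 𝐳-variables and into supp(b(𝐰)v) + ℤ² in the 𝐰-variables. -/
theorem stmt_5 (K : Type*) [Field K] [CharZero K]
    (E : Type*) [AddCommGroup E] [Module K E]
    (evE odE : Submodule K E) (hgr : IsCompl evE odE)
    (a b : EDist1 K E) (pa pb : ZMod 2)
    (ha : EDistPar K evE odE a pa) (hb : EDistPar K evE odE b pb)
    {r : ℕ} (c : Fin r → EDist2 K E) (h : Fin r → Idx K)
    (hch : IsOPE K E pa pb a b c h) (hred : ReducedExp K h) :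
    ∀ (i : Fin r) (v : E) (m k : Idx K), c i m k v ≠ 0 →
      (∃ m' : Idx K, a m' v ≠ 0 ∧ IsIntPair K (m - m')) ∧
      (∃ k' : Idx K, b k' v ≠ 0 ∧ IsIntPair K (k - k')) := by
  intro i v m k hc
  obtain ⟨hK, hf, hab, hba⟩ := hch
  constructor
  · by_contra! hno
    refine hc ?_
    have := eq_zero_of_sum_zwPow_eq_zero hK hred
      (fun j n l => negOnePow K ((-(h j)).1 - (-(h j)).2) • ev2 K E (c j) v l n)
      (fun j => (hf j v).smul_swap _) m (fun n l hl => ?_) i k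
    · exact (smul_eq_zero.1 this).resolve_left (negOnePow_ne_zero K _)
    · simp only [← zwPowW_eq_zwPow_swap]
      rw [← hba]
      have hal : a l v = 0 := by
        by_contra hne
        exact hno l hne hl.sub_comm
      rw [hal, map_zero, smul_zero]
  · by_contra! hno
    refine hc (eq_zero_of_sum_zwPow_eq_zero hK hred (fun j => ev2 K E (c j) v)
      (fun j => hf j v) k (fun n l hl => ?_) i m)
    have hbl : b l v = 0 := by
      by_contra hne
      exact hno l hne hl.sub_comm
    rw [← hab, hbl, map_zero]

end OPEA
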